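/- Fix reals a < b, x ∈ ℝ, t > 0 and an integer n ≥ 1. Then P_x( D_t ≥ n ) = P_0( T_c ≤ t ) = P_0( S_t ≥ c ), where c := |b−x| + (2n−1)(b−a), T_c = inf{ u ≥ 0 : X_u = c } is the first hitting time of level c by a Brownian motion started at 0, and S_t = sup_{0≤u≤t} X_u. -/

import Mathlib

open MeasureTheory ProbabilityTheory Filter
open scoped NNReal ENNReal Topology

noncomputable section

/-- The natural filtration `F_t = σ(X_s : s ≤ t)` of a real-valued process indexed by `ℝ≥0`. -/
def natFiltration {Ω : Type*} [m : MeasurableSpace Ω] (X : ℝ≥0 → Ω → ℝ) :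
    MeasureTheory.Filtration ℝ≥0 m where
  seq t := (⨆ s ∈ Set.Iic t, MeasurableSpace.comap (X s) Real.measurableSpace) ⊓ m
  mono' := fun s t hst =>
    inf_le_inf_right m (biSup_mono fun u (hu : u ∈ Set.Iic s) => le_trans hu hst)
  le' := fun _ => inf_le_right

/-- The running supremum `S_t = sup_{0 ≤ u ≤ t} X_u` of a process indexed by `ℝ≥0`. -/
def runSup {Ω : Type*} (X : ℝ≥0 → Ω → ℝ) (t : ℝ≥0) (ω : Ω) : ℝ :=
  sSup ((fun u => X u ω) '' Set.Iic t)

/-- A real-valued process `X` indexed by `ℝ≥0` is a standard one-dimensional Brownian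
motion started at `x` under `P`. -/
structure IsBrownianMotion {Ω : Type*} [m : MeasurableSpace Ω] (P : Measure Ω)
    (X : ℝ≥0 → Ω → ℝ) (x : ℝ) : Prop where
  stronglyMeasurable : ∀ t, StronglyMeasurable (X t)
  init : ∀ᵐ ω ∂P, X 0 ω = x
  cont : ∀ᵐ ω ∂P, Continuous fun t => X t ω
  gauss_incr : ∀ s t : ℝ≥0, s ≤ t →
    P.map (fun ω => X t ω - X s ω) = gaussianReal 0 (t - s)
  indep_incr : ∀ s t : ℝ≥0, s ≤ t →
    Indep (MeasurableSpace.comap (fun ω => X t ω - X s ω) Real.measurableSpace)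
      (natFiltration X s) P

open scoped Classical in
/-- The alternating sequence of stopping times of up-crossings of `b` and
down-crossings of `a`: `σ_0 = 0`, `σ_{2n+1} = inf{t ≥ σ_{2n} : X_t > b}`,
`σ_{2n+2} = inf{t ≥ σ_{2n+1} : X_t < a}` (with `inf ∅ = ∞`). -/
noncomputable def dcSigma {Ω : Type*} (a b : ℝ) (X : ℝ≥0 → Ω → ℝ) (ω : Ω) : ℕ → ℝ≥0∞
  | 0 => 0
  | Nat.succ n =>
      sInf ((fun u : ℝ≥0 => (u : ℝ≥0∞)) ''
        {u : ℝ≥0 | dcSigma a b X ω n ≤ (u : ℝ≥0∞) ∧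
          (if Even n then b < X u ω else X u ω < a)})

/-- `D_t`, the number of down-crossings from `b` to `a` before time `t`:
the number of indices `n ≥ 1` with `σ_{2n} ≤ t`. -/
noncomputable def dcD {Ω : Type*} (a b : ℝ) (X : ℝ≥0 → Ω → ℝ) (t : ℝ≥0) (ω : Ω) : ℕ :=
  Set.ncard {n : ℕ | 1 ≤ n ∧ dcSigma a b X ω (2 * n) ≤ (t : ℝ≥0∞)}

open scoped Classical in
/-- The down-crossing martingale `M_t^{↓,G}`. -/
noncomputable def dcM {Ω : Type*} (a b : ℝ) (G : ℕ → ℝ) (X : ℝ≥0 → Ω → ℝ)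
    (t : ℝ≥0) (ω : Ω) : ℝ :=
  ∑' n : ℕ,
    ((if dcSigma a b X ω (2 * n) ≤ (t : ℝ≥0∞) ∧ (t : ℝ≥0∞) < dcSigma a b X ω (2 * n + 1)
        then G n / 2 * (1 + (b - X t ω) / (b - a)) + G (n + 1) / 2 * ((X t ω - a) / (b - a))
        else 0)
      + (if dcSigma a b X ω (2 * n + 1) ≤ (t : ℝ≥0∞) ∧
            (t : ℝ≥0∞) < dcSigma a b X ω (2 * n + 2)
        then G (n + 1) / 2 * (1 + (b - X t ω) / (b - a)) + G n / 2 * ((X t ω - a) / (b - a))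
        else 0))

/-- The first hitting time of level `c`, `T_c = inf{u ≥ 0 : X_u = c}` (with `inf ∅ = ∞`). -/
noncomputable def hitTime {Ω : Type*} (X : ℝ≥0 → Ω → ℝ) (c : ℝ) (ω : Ω) : ℝ≥0∞ :=
  sInf ((fun u : ℝ≥0 => (u : ℝ≥0∞)) '' {u : ℝ≥0 | X u ω = c})

/-- The number of completed alternating passages above `b` and below `a` of a discrete path. -/
def phase (a b : ℝ) (x : ℕ → ℝ) : ℕ → ℕ
  | 0 => if b < x 0 then 1 else 0
  | k + 1 =>
      if (Even (phase a b x k) ∧ b < x (k + 1)) ∨ (¬ Even (phase a b x k) ∧ x (k + 1) < a)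
        then phase a b x k + 1 else phase a b x k

/-- The increment of a discrete path, with its sign flipped during the odd phases. -/
def foldIncr (a b : ℝ) (x : ℕ → ℝ) (k : ℕ) : ℝ :=
  if Even (phase a b x k) then x (k + 1) - x k else -(x (k + 1) - x k)

/-- The path obtained from a discrete path by reflecting it at each change of phase. -/
def foldWalk (a b : ℝ) (x : ℕ → ℝ) (k : ℕ) : ℝ :=
  ∑ i ∈ Finset.range k, foldIncr a b x i

lemma phase_mono (a b : ℝ) (x : ℕ → ℝ) : Monotone (phase a b x) := by
  refine monotone_nat_of_le_succ fun k => ?_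
  rw [phase]
  split_ifs <;> omega

lemma phase_le (a b : ℝ) (x : ℕ → ℝ) (k : ℕ) : phase a b x k ≤ k + 1 := by
  induction k with
  | zero => rw [phase]; split_ifs <;> omega
  | succ k ih => rw [phase]; split_ifs <;> omega

lemma foldWalk_succ (a b : ℝ) (x : ℕ → ℝ) (k : ℕ) :
    foldWalk a b x (k + 1) = foldWalk a b x k +
      if Even (phase a b x k) then x (k + 1) - x k else -(x (k + 1) - x k) := by
  rw [foldWalk, Finset.sum_range_succ, foldIncr, foldWalk]

lemma phase_side {a b : ℝ} (hab : a < b) (x : ℕ → ℝ) (k : ℕ) :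
    (Even (phase a b x k) → x k ≤ b) ∧ (¬ Even (phase a b x k) → a ≤ x k) := by
  cases k with
  | zero =>
    by_cases h : b < x 0
    · simp only [phase, h, if_true]
      exact ⟨fun h => by simp at h, fun _ => by linarith⟩
    · simp only [phase, h, if_false]
      exact ⟨fun _ => by linarith, fun h => by simp at h⟩
  | succ k =>
    rw [phase]
    by_cases he : Even (phase a b x k)
    · by_cases h : b < x (k + 1)
      · simp only [he, h, Nat.even_add_one, not_true_eq_false, true_and, true_or, if_true]
        exact ⟨fun h => h.elim, fun _ => by linarith⟩
      · simp only [he, h, not_true_eq_false, and_false, false_and, or_false, if_false]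
        exact ⟨fun _ => by linarith, fun h => h.elim⟩
    · by_cases h : x (k + 1) < a
      · simp only [he, h, Nat.even_add_one, not_false_eq_true, and_self, or_true, if_true]
        exact ⟨fun _ => by linarith, fun h => absurd trivial h⟩
      · simp only [he, h, not_false_eq_true, and_false, false_and, or_false, if_false]
        exact ⟨fun h => h.elim, fun _ => by linarith⟩

lemma foldWalk_lower (a b : ℝ) (x : ℕ → ℝ) (k : ℕ) :
    (Even (phase a b x k) →
        |b - x 0| - b + phase a b x k * (b - a) ≤ foldWalk a b x k - x k) ∧
      (¬ Even (phase a b x k) →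
        |b - x 0| + b + (phase a b x k - 1) * (b - a) ≤ foldWalk a b x k + x k) := by
  induction k with
  | zero =>
    by_cases h : b < x 0
    · simp [phase, h, foldWalk, abs_of_neg (sub_neg.2 h)]
    · simp [phase, h, foldWalk, abs_of_nonneg (sub_nonneg.2 (not_lt.1 h))]
  | succ k ih =>
    rw [foldWalk_succ, phase]
    by_cases he : Even (phase a b x k)
    · have ih := ih.1 he
      by_cases h : b < x (k + 1)
      · simp only [he, h, Nat.even_add_one, not_true_eq_false, true_and, true_or, if_true]
        exact ⟨fun h => h.elim, fun _ => by push_cast; linarith⟩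
      · simp only [he, h, not_true_eq_false, and_false, false_and, or_false, if_false, if_true]
        exact ⟨fun _ => by linarith, fun h => h.elim⟩
    · have ih := ih.2 he
      by_cases h : x (k + 1) < a
      · simp only [he, h, Nat.even_add_one, not_false_eq_true, and_self, or_true, if_true,
          if_false]
        exact ⟨fun _ => by push_cast; linarith, fun h => absurd trivial h⟩
      · simp only [he, h, not_false_eq_true, and_false, false_and, or_false, if_false]
        exact ⟨fun h => h.elim, fun _ => by linarith⟩

lemma le_partialSups_foldWalk (a b : ℝ) (x : ℕ → ℝ) (k : ℕ) (hk : 2 ≤ phase a b x k) :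
    |b - x 0| + (phase a b x k - 1) * (b - a) ≤ partialSups (foldWalk a b x) k := by
  induction k with
  | zero =>
    rw [phase] at hk
    split_ifs at hk <;> omega
  | succ k ih =>
    have hl := foldWalk_lower a b x k
    have hW := foldWalk_succ a b x k
    have hM := le_partialSups (foldWalk a b x) (k + 1)
    have hmono : partialSups (foldWalk a b x) k ≤ partialSups (foldWalk a b x) (k + 1) :=
      (partialSups _).monotone k.le_succ
    rw [phase] at hk ⊢
    split_ifs at hk ⊢ with h
    · push_cast
      rcases h with ⟨he, h⟩ | ⟨he, h⟩
      · rw [if_pos he] at hW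
        linarith [hl.1 he]
      · rw [if_neg he] at hW
        linarith [hl.2 he]
    · exact (ih hk).trans hmono

lemma foldWalk_upper {a b : ℝ} (hab : a < b) (x : ℕ → ℝ) {ε : ℝ} (hε : 0 ≤ ε) {m : ℕ}
    (hx : ∀ k < m, |x (k + 1) - x k| ≤ ε) (k : ℕ) (hk : k ≤ m) :
    (Even (phase a b x k) → foldWalk a b x k - x k ≤
        |b - x 0| - b + phase a b x k * (b - a) + 2 * phase a b x k * ε) ∧
      (¬ Even (phase a b x k) → foldWalk a b x k + x k ≤
        |b - x 0| + b + (phase a b x k - 1) * (b - a) + 2 * phase a b x k * ε) := by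
  induction k with
  | zero =>
    by_cases h : b < x 0
    · simp [phase, h, foldWalk, abs_of_neg (sub_neg.2 h), hε]
    · simp [phase, h, foldWalk, abs_of_nonneg (sub_nonneg.2 (not_lt.1 h))]
  | succ k ih =>
    have ih := ih (by omega)
    have hs := phase_side hab x k
    have hd := abs_le.1 (hx k (by omega))
    rw [foldWalk_succ, phase]
    by_cases he : Even (phase a b x k)
    · have ih := ih.1 he
      have hs := hs.1 he
      by_cases h : b < x (k + 1)
      · simp only [he, h, Nat.even_add_one, not_true_eq_false, true_and, true_or, if_true]
        exact ⟨fun h => h.elim, fun _ => by push_cast; linarith⟩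
      · simp only [he, h, not_true_eq_false, and_false, false_and, or_false, if_false, if_true]
        exact ⟨fun _ => by linarith, fun h => h.elim⟩
    · have ih := ih.2 he
      have hs := hs.2 he
      by_cases h : x (k + 1) < a
      · simp only [he, h, Nat.even_add_one, not_false_eq_true, and_self, or_true, if_true,
          if_false]
        exact ⟨fun _ => by push_cast; linarith, fun h => absurd trivial h⟩
      · simp only [he, h, not_false_eq_true, and_false, false_and, or_false, if_false]
        exact ⟨fun h => h.elim, fun _ => by linarith⟩

lemma partialSups_foldWalk_le {a b : ℝ} (hab : a < b) (x : ℕ → ℝ) {ε : ℝ} (hε : 0 ≤ ε) {m : ℕ}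
    (hx : ∀ k < m, |x (k + 1) - x k| ≤ ε) :
    partialSups (foldWalk a b x) m ≤
      |b - x 0| + phase a b x m * (b - a) + 2 * phase a b x m * ε := by
  refine partialSups_le_iff.2 fun k hk => ?_
  have hu := foldWalk_upper hab x hε hx k hk
  have hs := phase_side hab x k
  have hp : (phase a b x k : ℝ) ≤ phase a b x m := by exact_mod_cast phase_mono a b x hk
  have h1 : (phase a b x k : ℝ) * (b - a) ≤ phase a b x m * (b - a) :=
    mul_le_mul_of_nonneg_right hp (by linarith)
  have h2 : (phase a b x k : ℝ) * ε ≤ phase a b x m * ε := mul_le_mul_of_nonneg_right hp hε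
  by_cases he : Even (phase a b x k)
  · linarith [hu.1 he, hs.1 he]
  · linarith [hu.2 he, hs.2 he]

/-- The values of a process along the grid `s, s + h, s + 2h, …`. -/
def gridPath {Ω : Type*} (X : ℝ≥0 → Ω → ℝ) (s h : ℝ≥0) (ω : Ω) (k : ℕ) : ℝ :=
  X (s + k * h) ω

lemma exists_closure_of_sInf_coe_le {A : Set ℝ≥0} {t : ℝ≥0}
    (h : sInf ((fun u : ℝ≥0 => (u : ℝ≥0∞)) '' A) ≤ t) :
    ∃ τ : ℝ≥0, (τ : ℝ≥0∞) = sInf ((fun u : ℝ≥0 => (u : ℝ≥0∞)) '' A) ∧ τ ≤ t ∧ τ ∈ closure A := by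
  have hne : A.Nonempty := by
    by_contra hA
    simp [Set.not_nonempty_iff_eq_empty.1 hA] at h
  obtain ⟨τ, hτ⟩ := WithTop.ne_top_iff_exists.1 (h.trans_lt ENNReal.coe_lt_top).ne
  refine ⟨τ, hτ, ENNReal.coe_le_coe.1 (hτ.trans_le h), ?_⟩
  have hcl := sInf_mem_closure (hne.image fun u : ℝ≥0 => (u : ℝ≥0∞))
  rw [← hτ] at hcl
  rwa [ENNReal.isOpenEmbedding_coe.isInducing.closure_eq_preimage_closure_image]

section paths

variable {Ω : Type*} {X : ℝ≥0 → Ω → ℝ} {ω : Ω}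

lemma dcSigma_succ (a b : ℝ) (X : ℝ≥0 → Ω → ℝ) (ω : Ω) (p : ℕ) :
    dcSigma a b X ω (p + 1) = sInf ((fun u : ℝ≥0 => (u : ℝ≥0∞)) ''
      {u : ℝ≥0 | dcSigma a b X ω p ≤ u ∧ (if Even p then b < X u ω else X u ω < a)}) := by
  rw [dcSigma]

lemma dcSigma_mono (a b : ℝ) (X : ℝ≥0 → Ω → ℝ) (ω : Ω) : Monotone (dcSigma a b X ω) := by
  refine monotone_nat_of_le_succ fun p => ?_
  rw [dcSigma_succ]
  refine le_sInf ?_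
  rintro _ ⟨u, hu, rfl⟩
  exact hu.1

lemma exists_dcSigma_succ (hc : Continuous fun u => X u ω) {a b : ℝ} {p : ℕ} {t : ℝ≥0}
    (h : dcSigma a b X ω (p + 1) ≤ t) :
    ∃ τ : ℝ≥0, (τ : ℝ≥0∞) = dcSigma a b X ω (p + 1) ∧ τ ≤ t ∧
      (if Even p then b ≤ X τ ω else X τ ω ≤ a) := by
  rw [dcSigma_succ] at h ⊢
  obtain ⟨τ, h1, h2, h3⟩ := exists_closure_of_sInf_coe_le h
  refine ⟨τ, h1, h2, ?_⟩
  split_ifs with he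
  · refine closure_minimal (t := {u | b ≤ X u ω}) (fun u hu => ?_)
      (isClosed_le continuous_const hc) h3
    exact le_of_lt (by simpa [he] using hu.2)
  · refine closure_minimal (t := {u | X u ω ≤ a}) (fun u hu => ?_)
      (isClosed_le hc continuous_const) h3
    exact le_of_lt (by simpa [he] using hu.2)

lemma dcSigma_le_of_le_phase {a b : ℝ} (h : ℝ≥0) (k p : ℕ)
    (hp : p ≤ phase a b (gridPath X 0 h ω) k) :
    dcSigma a b X ω p ≤ ((k * h : ℝ≥0) : ℝ≥0∞) := by
  induction k generalizing p with
  | zero =>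
    rcases p with _ | _ | p
    · simp [dcSigma]
    · rw [phase] at hp
      split_ifs at hp with h0
      · rw [dcSigma_succ]
        refine sInf_le ⟨_, ⟨by simp [dcSigma], ?_⟩, rfl⟩
        simpa [gridPath] using h0
      · omega
    · rw [phase] at hp
      split_ifs at hp <;> omega
  | succ k ih =>
    have hle : ((k * h : ℝ≥0) : ℝ≥0∞) ≤ (((k + 1 : ℕ) * h : ℝ≥0) : ℝ≥0∞) := by
      gcongr
      simp
    rcases Nat.lt_or_ge (phase a b (gridPath X 0 h ω) k) p with hlt | hge
    · rw [phase] at hp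
      split_ifs at hp with hs
      · obtain rfl : p = phase a b (gridPath X 0 h ω) k + 1 := by omega
        rw [dcSigma_succ]
        refine sInf_le ⟨_, ⟨(ih _ le_rfl).trans hle, ?_⟩, rfl⟩
        rcases hs with ⟨he, hs⟩ | ⟨he, hs⟩
        · simpa [he, gridPath] using hs
        · simpa [he, gridPath] using hs
      · omega
    · exact (ih p hge).trans hle

lemma le_phase_of_dcSigma_le (hc : Continuous fun u => X u ω) {a b δ : ℝ} (hab : a + δ < b - δ)
    {h t : ℝ≥0}
    (hosc : ∀ u ≤ t, |X (⌊u / h⌋₊ * h) ω - X u ω| < δ) (p : ℕ) (hp : dcSigma a b X ω p ≤ t) :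
    p ≤ phase (a + δ) (b - δ) (gridPath X 0 h ω) ⌊(dcSigma a b X ω p).toNNReal / h⌋₊ := by
  induction p with
  | zero => simp
  | succ p ih =>
    have hσ := dcSigma_mono a b X ω p.le_succ
    have ih := ih (hσ.trans hp)
    obtain ⟨τ, h1, h2, h3⟩ := exists_dcSigma_succ hc hp
    rw [← h1] at hσ ⊢
    have hle : (dcSigma a b X ω p).toNNReal ≤ τ := ENNReal.toNNReal_mono ENNReal.coe_ne_top hσ
    rw [ENNReal.toNNReal_coe]
    have ih := ih.trans (phase_mono _ _ _ (Nat.floor_mono (div_le_div_of_nonneg_right hle h.2)))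
    refine Nat.succ_le_of_lt (lt_of_le_of_ne ih fun heq => ?_)
    have hs := phase_side hab (gridPath X 0 h ω) ⌊τ / h⌋₊
    rw [← heq] at hs
    have hd := abs_lt.1 (hosc τ h2)
    simp only [gridPath, zero_add] at hs
    split_ifs at h3 with he
    · linarith [hs.1 he]
    · linarith [hs.2 he]

lemma eventually_osc_lt (hc : Continuous fun u => X u ω) (t : ℝ≥0) {δ : ℝ} (hδ : 0 < δ)
    (r : ℝ≥0) :
    ∀ᶠ N : ℕ in atTop, ∀ u ≤ t, ∀ v ≤ t, dist u v ≤ r / (N + 1) → |X u ω - X v ω| < δ := by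
  have huc := (isCompact_Icc (a := (0 : ℝ≥0)) (b := t)).uniformContinuousOn_of_continuous
    hc.continuousOn
  obtain ⟨η, hη, H⟩ := Metric.uniformContinuousOn_iff.1 huc δ hδ
  have hlim : Tendsto (fun N : ℕ => (r : ℝ) / (N + 1)) atTop (𝓝 0) := by
    simpa [div_eq_mul_inv] using
      (tendsto_one_div_add_atTop_nhds_zero_nat (𝕜 := ℝ)).const_mul (r : ℝ)
  filter_upwards [hlim.eventually_lt_const hη] with N hN u hu v hv huv
  exact H u ⟨u.2, hu⟩ v ⟨v.2, hv⟩ (huv.trans_lt hN)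

lemma floor_div_mul_le {h : ℝ≥0} (hh : 0 < h) (u : ℝ≥0) : ⌊u / h⌋₊ * h ≤ u := by
  have := mul_le_mul_left (Nat.floor_le (zero_le (a := u / h))) h
  rwa [div_mul_cancel₀ _ hh.ne'] at this

lemma dist_floor_div_mul_le {h : ℝ≥0} (hh : 0 < h) (u : ℝ≥0) : dist (⌊u / h⌋₊ * h) u ≤ h := by
  have h1 := floor_div_mul_le hh u
  have h2 : u ≤ (⌊u / h⌋₊ + 1) * h := by
    have := mul_le_mul_left (Nat.lt_floor_add_one (u / h)).le h
    rwa [div_mul_cancel₀ _ hh.ne'] at this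
  rw [NNReal.dist_eq, abs_le]
  have h1' : ((⌊u / h⌋₊ * h : ℝ≥0) : ℝ) ≤ u := by exact_mod_cast h1
  have h2' : (u : ℝ) ≤ (⌊u / h⌋₊ * h : ℝ≥0) + h := by
    rw [add_mul, one_mul] at h2
    exact_mod_cast h2
  constructor
  · linarith
  · linarith [h.2]

lemma eventually_grid_approx (hc : Continuous fun u => X u ω) (s r : ℝ≥0) (hr : 0 < r) {δ : ℝ}
    (hδ : 0 < δ) :
    ∀ᶠ N : ℕ in atTop, ∀ u ≤ r,
      |X (s + ⌊u / (r / (N + 1))⌋₊ * (r / (N + 1))) ω - X (s + u) ω| < δ := by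
  filter_upwards [eventually_osc_lt hc (s + r) hδ r] with N hN u hu
  have hh : 0 < r / (N + 1) := by positivity
  refine hN _ (add_le_add_right ((floor_div_mul_le hh u).trans hu) s) _
    (add_le_add_right hu s) ?_
  have hd := dist_floor_div_mul_le hh u
  rw [NNReal.dist_eq] at hd ⊢
  push_cast at hd ⊢
  rwa [add_sub_add_left_eq_sub]

lemma floor_le_steps {r : ℝ≥0} (N : ℕ) {u : ℝ≥0} (hu : u ≤ r) :
    ⌊u / (r / (N + 1))⌋₊ ≤ N + 1 := by
  rw [← Nat.cast_le (α := ℝ≥0)]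
  refine (Nat.floor_le zero_le).trans ?_
  rw [div_div_eq_mul_div]
  refine div_le_of_le_mul₀ zero_le zero_le ?_
  push_cast
  rw [mul_comm]
  gcongr

lemma steps_mul (r : ℝ≥0) (N : ℕ) : ((N + 1 : ℕ) : ℝ≥0) * (r / (N + 1)) = r := by
  push_cast
  exact mul_div_cancel₀ _ (by positivity)

lemma steps_mul_le (r : ℝ≥0) (N : ℕ) {k : ℕ} (hk : k ≤ N + 1) : (k : ℝ≥0) * (r / (N + 1)) ≤ r :=
  (mul_le_mul_left (Nat.cast_le.2 hk) _).trans_eq (steps_mul r N)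

lemma eventually_le_phase (hc : Continuous fun u => X u ω) {a b δ : ℝ} (hδ : 0 < δ)
    (hab : a + δ < b - δ) {t : ℝ≥0} (ht : 0 < t) (p : ℕ) (hp : dcSigma a b X ω p ≤ t) :
    ∀ᶠ N : ℕ in atTop, p ≤ phase (a + δ) (b - δ) (gridPath X 0 (t / (N + 1)) ω) (N + 1) := by
  filter_upwards [eventually_grid_approx hc 0 t ht hδ] with N hN
  refine (le_phase_of_dcSigma_le hc hab (h := t / (N + 1))
    (by simpa using hN) p hp).trans (phase_mono _ _ _ (floor_le_steps N ?_))
  exact ENNReal.toNNReal_mono ENNReal.coe_ne_top hp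

lemma le_runSup (hc : Continuous fun u => X u ω) {u t : ℝ≥0} (hu : u ≤ t) :
    X u ω ≤ runSup X t ω := by
  rw [runSup, ← Set.Icc_bot]
  exact le_csSup (isCompact_Icc.image hc).bddAbove ⟨u, ⟨bot_le, hu⟩, rfl⟩

lemma exists_eq_runSup (hc : Continuous fun u => X u ω) (t : ℝ≥0) :
    ∃ u ≤ t, X u ω = runSup X t ω := by
  rw [runSup, ← Set.Icc_bot]
  obtain ⟨u, hu, h⟩ := (isCompact_Icc.image hc).sSup_mem
    ((Set.nonempty_Icc.2 (bot_le : ⊥ ≤ t)).image fun u => X u ω)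
  exact ⟨u, hu.2, h⟩

lemma partialSups_gridPath_le_runSup (hc : Continuous fun u => X u ω) (t : ℝ≥0) (N : ℕ) :
    partialSups (gridPath X 0 (t / (N + 1)) ω) (N + 1) ≤ runSup X t ω :=
  partialSups_le_iff.2 fun _ hk => le_runSup hc (by simpa using steps_mul_le t N hk)

lemma tendsto_partialSups_gridPath (hc : Continuous fun u => X u ω) {t : ℝ≥0} (ht : 0 < t) :
    Tendsto (fun N : ℕ => partialSups (gridPath X 0 (t / (N + 1)) ω) (N + 1)) atTop
      (𝓝 (runSup X t ω)) := by
  obtain ⟨u, hu, hu'⟩ := exists_eq_runSup hc t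
  refine Metric.tendsto_nhds.2 fun δ hδ => ?_
  filter_upwards [eventually_grid_approx hc 0 t ht hδ] with N hN
  have h1 := partialSups_gridPath_le_runSup hc t N
  have h2 := le_partialSups_of_le (gridPath X 0 (t / (N + 1)) ω) (floor_le_steps N hu)
  have h3 := abs_lt.1 (hN u hu)
  simp only [gridPath, zero_add] at h1 h2 h3
  rw [Real.dist_eq, abs_lt]
  constructor <;> linarith

lemma hitTime_le_iff (hc : Continuous fun u => X u ω) (h0 : X 0 ω = 0) {c : ℝ} (hcpos : 0 ≤ c)
    (t : ℝ≥0) : hitTime X c ω ≤ t ↔ c ≤ runSup X t ω := by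
  constructor
  · intro h
    obtain ⟨τ, -, h2, h3⟩ := exists_closure_of_sInf_coe_le h
    have : X τ ω = c := closure_minimal (fun _ hu => hu) (isClosed_eq hc continuous_const) h3
    exact this ▸ le_runSup hc h2
  · intro h
    obtain ⟨u, hu, hu'⟩ := exists_eq_runSup hc t
    obtain ⟨v, hv, hv'⟩ := intermediate_value_Icc (zero_le (a := u)) hc.continuousOn
      (show c ∈ Set.Icc (X 0 ω) (X u ω) from ⟨by rwa [h0], by rwa [hu']⟩)
    have hvt : (v : ℝ≥0∞) ≤ t := by exact_mod_cast hv.2.trans hu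
    have hle : hitTime X c ω ≤ v := sInf_le ⟨v, hv', rfl⟩
    exact hle.trans hvt

lemma exists_lt_dcSigma (hc : Continuous fun u => X u ω) {a b : ℝ} (hab : a < b) {t : ℝ≥0}
    (ht : 0 < t) : ∃ p, ¬ dcSigma a b X ω p ≤ t := by
  set δ := (b - a) / 4 with hδ
  obtain ⟨N, hN⟩ := (eventually_grid_approx hc 0 t ht (δ := δ) (by linarith)).exists
  refine ⟨N + 3, fun hp => ?_⟩
  have := (le_phase_of_dcSigma_le hc (a := a) (b := b) (δ := δ) (h := t / (N + 1)) (by linarith)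
    (by simpa using hN) _ hp).trans
    (phase_mono _ _ _ (floor_le_steps N (ENNReal.toNNReal_mono ENNReal.coe_ne_top hp)))
  have := this.trans (phase_le _ _ _ _)
  omega

lemma le_dcD_iff (hc : Continuous fun u => X u ω) {a b : ℝ} (hab : a < b) {t : ℝ≥0}
    (ht : 0 < t) {n : ℕ} (hn : 1 ≤ n) :
    n ≤ dcD a b X t ω ↔ dcSigma a b X ω (2 * n) ≤ t := by
  constructor
  · intro h
    by_contra hcon
    have hsub : {k : ℕ | 1 ≤ k ∧ dcSigma a b X ω (2 * k) ≤ t} ⊆ Set.Ico 1 n := by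
      refine fun k hk => ⟨hk.1, not_le.1 fun hnk => hcon ?_⟩
      exact (dcSigma_mono a b X ω (by omega)).trans hk.2
    have := Set.ncard_le_ncard hsub (Set.finite_Ico 1 n)
    rw [Set.ncard_Ico_nat] at this
    have := h.trans this
    omega
  · intro h
    obtain ⟨p, hp⟩ := exists_lt_dcSigma hc hab ht
    have hfin : {k : ℕ | 1 ≤ k ∧ dcSigma a b X ω (2 * k) ≤ t}.Finite := by
      refine (Set.finite_Iio p).subset fun k hk => Set.mem_Iio.2 (not_le.1 fun hpk => hp ?_)
      exact (dcSigma_mono a b X ω (by omega)).trans hk.2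
    have hsub : Set.Icc 1 n ⊆ {k : ℕ | 1 ≤ k ∧ dcSigma a b X ω (2 * k) ≤ t} :=
      fun k hk => ⟨hk.1, (dcSigma_mono a b X ω (by have := hk.2; omega)).trans h⟩
    have := Set.ncard_le_ncard hsub hfin
    rwa [Set.ncard_Icc_nat, Nat.add_sub_cancel] at this

end paths

section measure

variable {Ω : Type*} {F mΩ : MeasurableSpace Ω} {P : Measure Ω}

lemma measure_le_of_ae_eventually_mem {A : Set Ω} {B : ℕ → Set Ω} {r : ℝ≥0∞}
    (h : ∀ᵐ ω ∂P, ω ∈ A → ∀ᶠ N in atTop, ω ∈ B N) (hr : ∃ᶠ N in atTop, P (B N) ≤ r) :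
    P A ≤ r := by
  have hsub : A ≤ᵐ[P] ⋃ n, ⋂ N ≥ n, B N := by
    filter_upwards [h] with ω hω hA
    obtain ⟨n, hn⟩ := eventually_atTop.1 (hω hA)
    exact Set.mem_iUnion.2 ⟨n, Set.mem_iInter₂.2 hn⟩
  refine (measure_mono_ae hsub).trans ?_
  rw [Monotone.measure_iUnion]
  · refine iSup_le fun n => ?_
    obtain ⟨N, hN, hB⟩ := (frequently_atTop.1 hr) n
    exact (measure_mono (Set.iInter₂_subset N hN)).trans hB
  · exact fun i j hij => Set.biInter_subset_biInter_left fun N hN => le_trans hij hN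

lemma le_measure_of_ae_eventually_notMem [IsProbabilityMeasure P] {A : Set Ω} {B : ℕ → Set Ω}
    {r : ℝ≥0∞} (hB : ∀ N, NullMeasurableSet (B N) P)
    (h : ∀ᵐ ω ∂P, ω ∉ A → ∀ᶠ N in atTop, ω ∉ B N) (hr : ∃ᶠ N in atTop, r ≤ P (B N)) :
    r ≤ P A := by
  have h1 : P Aᶜ ≤ 1 - r :=
    measure_le_of_ae_eventually_mem (B := fun N => (B N)ᶜ) h (hr.mono fun N hN => by
      rw [prob_compl_eq_one_sub₀ (hB N)]
      exact tsub_le_tsub_left hN 1)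
  have h2 : 1 ≤ P A + P Aᶜ := by
    rw [← measure_univ (μ := P), ← Set.union_compl_self A]
    exact measure_union_le _ _
  obtain ⟨N, hN⟩ := hr.exists
  have hr1 : r ≤ 1 := hN.trans prob_le_one
  have h3 : 1 - r + r ≤ 1 - r + P A := by
    rw [tsub_add_cancel_of_le hr1, add_comm]
    exact h2.trans (by gcongr)
  exact (ENNReal.add_le_add_iff_left (ENNReal.sub_ne_top ENNReal.one_ne_top)).1 h3

/-- `η` has law `γ` and is independent of the `σ`-algebra `F`. -/
def HasFreshLaw (P : Measure Ω) (F : MeasurableSpace Ω) (γ : Measure ℝ) (η : Ω → ℝ) : Prop :=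
  ∀ ⦃C : Set Ω⦄, MeasurableSet[F] C → ∀ ⦃B : Set ℝ⦄, MeasurableSet B →
    P (C ∩ η ⁻¹' B) = P C * γ B

variable {γ : Measure ℝ} {η : Ω → ℝ}

lemma HasFreshLaw.map_prodMk [IsFiniteMeasure P] [SigmaFinite γ] {α : Type*} [MeasurableSpace α]
    (h : HasFreshLaw P F γ η) (hF : F ≤ mΩ) (hη : Measurable η) {U : Ω → α}
    (hU : Measurable[F] U) : P.map (fun ω => (U ω, η ω)) = (P.map U).prod γ := by
  have hU' : Measurable U := hU.mono hF le_rfl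
  refine (Measure.prod_eq fun s t hs ht => ?_).symm
  rw [Measure.map_apply (hU'.prodMk hη) (hs.prod ht), Measure.map_apply hU' hs]
  exact h (hU hs) ht

lemma HasFreshLaw.ite_neg (h : HasFreshLaw P F γ η) (hF : F ≤ mΩ)
    (hγ : γ.map (fun z => -z) = γ) {p : Ω → Prop} [DecidablePred p]
    (hp : MeasurableSet[F] {ω | p ω}) :
    HasFreshLaw P F γ (fun ω => if p ω then η ω else -η ω) := by
  intro C hC B hB
  have h1 : C ∩ (fun ω => if p ω then η ω else -η ω) ⁻¹' B ∩ {ω | p ω} =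
      (C ∩ {ω | p ω}) ∩ η ⁻¹' B := by
    ext ω
    by_cases hω : p ω <;> simp [hω]
  have h2 : (C ∩ (fun ω => if p ω then η ω else -η ω) ⁻¹' B) \ {ω | p ω} =
      (C \ {ω | p ω}) ∩ η ⁻¹' ((fun z => -z) ⁻¹' B) := by
    ext ω
    by_cases hω : p ω <;> simp [hω]
  rw [← measure_inter_add_sdiff _ (hF _ hp), h1, h2, h (hC.inter hp) hB,
    h (hC.diff hp) (measurable_neg hB), ← Measure.map_apply measurable_neg hB, hγ, ← add_mul,
    measure_inter_add_sdiff _ (hF _ hp)]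

/-- The joint law of a random walk with step law `γ` and of its running maximum. -/
def walkMaxLaw (γ : Measure ℝ) : ℕ → Measure (ℝ × ℝ)
  | 0 => Measure.dirac (0, 0)
  | k + 1 => ((walkMaxLaw γ k).prod γ).map
      (fun q => (q.1.1 + q.2, max q.1.2 (q.1.1 + q.2)))

instance (γ : Measure ℝ) [IsProbabilityMeasure γ] (k : ℕ) :
    IsProbabilityMeasure (walkMaxLaw γ k) := by
  induction k with
  | zero => rw [walkMaxLaw]; infer_instance
  | succ k ih =>
    rw [walkMaxLaw]
    exact Measure.isProbabilityMeasure_map (by fun_prop)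

lemma measurable_partialSups {G : MeasurableSpace Ω} {w : Ω → ℕ → ℝ} (k : ℕ)
    (hw : ∀ j ≤ k, Measurable[G] fun ω => w ω j) :
    Measurable[G] fun ω => partialSups (w ω) k := by
  induction k with
  | zero => simpa using hw 0 le_rfl
  | succ k ih =>
    simp only [partialSups_add_one]
    exact (ih fun j hj => hw j (by omega)).sup (hw _ le_rfl)

lemma map_walk_partialSups [IsProbabilityMeasure P] [IsProbabilityMeasure γ]
    (F : Filtration ℕ mΩ) {η : ℕ → Ω → ℝ} (hm : ∀ k, Measurable[F (k + 1)] (η k))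
    (hη : ∀ k, HasFreshLaw P (F k) γ (η k)) {Z : Ω → ℝ} (hZ : Measurable[F 0] Z) (k : ℕ) :
    P.map (fun ω => (Z ω, ((∑ i ∈ Finset.range k, η i ω),
        partialSups (fun j => ∑ i ∈ Finset.range j, η i ω) k))) =
      (P.map Z).prod (walkMaxLaw γ k) := by
  have hW : ∀ k, Measurable[F k] fun ω => ∑ i ∈ Finset.range k, η i ω := fun k =>
    Finset.measurable_fun_sum _ fun i hi =>
      (hm i).mono (F.mono (Finset.mem_range.1 hi)) le_rfl
  have hZ' : Measurable Z := hZ.mono (F.le 0) le_rfl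
  have hU : ∀ k, Measurable[F k] fun ω => (Z ω, ((∑ i ∈ Finset.range k, η i ω),
      partialSups (fun j => ∑ i ∈ Finset.range j, η i ω) k)) := fun k =>
    (hZ.mono (F.mono k.zero_le) le_rfl).prodMk ((hW k).prodMk
      (measurable_partialSups k fun j hj => (hW j).mono (F.mono hj) le_rfl))
  induction k with
  | zero =>
    simp only [Finset.range_zero, Finset.sum_empty, partialSups_zero, walkMaxLaw]
    rw [Measure.prod_dirac, Measure.map_map (by fun_prop) hZ']
    rfl
  | succ k ih =>
    have hstep : (fun ω => (Z ω, ((∑ i ∈ Finset.range (k + 1), η i ω),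
        partialSups (fun j => ∑ i ∈ Finset.range j, η i ω) (k + 1)))) =
        Prod.map id (fun q : (ℝ × ℝ) × ℝ => (q.1.1 + q.2, max q.1.2 (q.1.1 + q.2))) ∘
          MeasurableEquiv.prodAssoc ∘ fun ω => ((Z ω, ((∑ i ∈ Finset.range k, η i ω),
            partialSups (fun j => ∑ i ∈ Finset.range j, η i ω) k)), η k ω) := by
      funext ω
      simp [partialSups_add_one, Finset.sum_range_succ, MeasurableEquiv.prodAssoc]
    have hη' : Measurable (η k) := (hm k).mono (F.le _) le_rfl
    have hφ : Measurable fun q : (ℝ × ℝ) × ℝ => (q.1.1 + q.2, max q.1.2 (q.1.1 + q.2)) := by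
      fun_prop
    have hUk := (hU k).mono (F.le k) le_rfl
    rw [hstep, ← Measure.map_map (measurable_id.prodMap hφ)
        (MeasurableEquiv.prodAssoc.measurable.comp (hUk.prodMk hη')),
      ← Measure.map_map MeasurableEquiv.prodAssoc.measurable (hUk.prodMk hη'),
      (hη k).map_prodMk (F.le k) hη' (hU k), ih, Measure.prodAssoc_prod,
      ← Measure.map_prod_map _ _ measurable_id hφ, Measure.map_id, walkMaxLaw]

lemma gaussianReal_Icc_le {v : ℝ≥0} (hv : v ≠ 0) (l u : ℝ) :
    gaussianReal 0 v (Set.Icc l u) ≤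
      ENNReal.ofReal (√(2 * Real.pi * v))⁻¹ * ENNReal.ofReal (u - l) := by
  rw [gaussianReal_apply _ hv]
  refine (lintegral_mono (g := fun _ => ENNReal.ofReal (√(2 * Real.pi * v))⁻¹) fun z => ?_).trans
    (by rw [setLIntegral_const, Real.volume_Icc])
  refine ENNReal.ofReal_le_ofReal ?_
  rw [gaussianPDFReal_def]
  refine mul_le_of_le_one_right (by positivity) (Real.exp_le_one_iff.2 ?_)
  rw [neg_div]
  exact neg_nonpos.2 (by positivity)

lemma gaussianReal_prod_add_mem_Icc_le {v : ℝ≥0} (hv : v ≠ 0) (ν : Measure (ℝ × ℝ))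
    [IsProbabilityMeasure ν] (l u : ℝ) :
    ((gaussianReal 0 v).prod ν) {q | q.1 + q.2.2 ∈ Set.Icc l u} ≤
      ENNReal.ofReal (√(2 * Real.pi * v))⁻¹ * ENNReal.ofReal (u - l) := by
  have hmeas : MeasurableSet {q : ℝ × (ℝ × ℝ) | q.1 + q.2.2 ∈ Set.Icc l u} :=
    measurableSet_Icc.preimage (by fun_prop)
  rw [Measure.prod_apply_symm hmeas]
  refine (lintegral_mono (g := fun _ =>
    ENNReal.ofReal (√(2 * Real.pi * v))⁻¹ * ENNReal.ofReal (u - l)) fun y => ?_).trans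
    (by simp)
  have : (fun z => (z, y)) ⁻¹' {q : ℝ × (ℝ × ℝ) | q.1 + q.2.2 ∈ Set.Icc l u} =
      Set.Icc (l - y.2) (u - y.2) := by
    ext z
    simp [le_sub_iff_add_le]
  rw [this]
  exact (gaussianReal_Icc_le hv _ _).trans_eq (by rw [sub_sub_sub_cancel_right])

end measure

section brownian

variable {Ω : Type*} [mΩ : MeasurableSpace Ω] {P : Measure Ω} {X : ℝ≥0 → Ω → ℝ} {x : ℝ}

lemma IsBrownianMotion.measurable_natFiltration (hX : IsBrownianMotion P X x) {s t : ℝ≥0}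
    (hst : s ≤ t) : Measurable[natFiltration X t] (X s) := by
  refine Measurable.of_comap_le (le_inf ?_ (hX.stronglyMeasurable s).measurable.comap_le)
  exact le_iSup₂_of_le (f := fun s (_ : s ∈ Set.Iic t) =>
    MeasurableSpace.comap (X s) Real.measurableSpace) s hst le_rfl

lemma IsBrownianMotion.hasFreshLaw (hX : IsBrownianMotion P X x) (s h : ℝ≥0) (k : ℕ) :
    HasFreshLaw P (natFiltration X (s + k * h)) (gaussianReal 0 h)
      (fun ω => gridPath X s h ω (k + 1) - gridPath X s h ω k) := by
  have hle : s + k * h ≤ s + (k + 1 : ℕ) * h := by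
    gcongr
    simp
  have hsub : s + (k + 1 : ℕ) * h - (s + k * h) = h := by
    rw [Nat.cast_add_one, add_mul, one_mul, ← add_assoc, add_tsub_cancel_left]
  intro C hC B hB
  have hlaw := hX.gauss_incr _ _ hle
  rw [hsub] at hlaw
  have := (Indep_iff _ _ _).1 (hX.indep_incr _ _ hle) _ C ⟨B, hB, rfl⟩ hC
  rw [Set.inter_comm, mul_comm, ← hlaw, Measure.map_apply _ hB]
  · exact this
  · exact (hX.stronglyMeasurable _).measurable.sub (hX.stronglyMeasurable _).measurable

/-- The natural filtration of a process along the grid `s, s + h, s + 2h, …`. -/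
def gridFiltration (X : ℝ≥0 → Ω → ℝ) (s h : ℝ≥0) : Filtration ℕ mΩ where
  seq k := natFiltration X (s + k * h)
  mono' := fun i j hij => (natFiltration X).mono (by gcongr)
  le' := fun _ => (natFiltration X).le _

lemma IsBrownianMotion.measurable_gridPath (hX : IsBrownianMotion P X x) (s h : ℝ≥0) {j k : ℕ}
    (hjk : j ≤ k) : Measurable[gridFiltration X s h k] fun ω => gridPath X s h ω j :=
  hX.measurable_natFiltration (by gcongr)

lemma IsBrownianMotion.measurable_phase (hX : IsBrownianMotion P X x) (a b : ℝ) (s h : ℝ≥0)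
    (k : ℕ) : Measurable[gridFiltration X s h k] fun ω => phase a b (gridPath X s h ω) k := by
  induction k with
  | zero =>
    simp only [phase]
    exact Measurable.ite (measurableSet_lt measurable_const (hX.measurable_gridPath s h le_rfl))
      measurable_const measurable_const
  | succ k ih =>
    simp only [phase]
    have ih := ih.mono ((gridFiltration X s h).mono k.le_succ) le_rfl
    have hx := hX.measurable_gridPath s h (le_refl (k + 1))
    have he : MeasurableSet[gridFiltration X s h (k + 1)]
        {ω | Even (phase a b (gridPath X s h ω) k)} :=
      ih (MeasurableSet.of_discrete (s := {n : ℕ | Even n}))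
    refine Measurable.ite ?_ (ih.add_const 1) ih
    exact (he.inter (measurableSet_lt measurable_const hx)).union
      (he.compl.inter (measurableSet_lt hx measurable_const))

lemma IsBrownianMotion.map_foldWalk [IsProbabilityMeasure P] (hX : IsBrownianMotion P X x)
    (a b : ℝ) (s h : ℝ≥0) (k : ℕ) :
    P.map (fun ω => (X s ω, (foldWalk a b (gridPath X s h ω) k,
        partialSups (foldWalk a b (gridPath X s h ω)) k))) =
      (P.map (X s)).prod (walkMaxLaw (gaussianReal 0 h) k) := by
  refine map_walk_partialSups (gridFiltration X s h)
    (η := fun k ω => foldIncr a b (gridPath X s h ω) k) (fun k => ?_) (fun k => ?_)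
    (hX.measurable_natFiltration le_self_add) k
  · have he : MeasurableSet[gridFiltration X s h (k + 1)]
        {ω | Even (phase a b (gridPath X s h ω) k)} :=
      ((hX.measurable_phase a b s h k).mono ((gridFiltration X s h).mono k.le_succ) le_rfl)
        (MeasurableSet.of_discrete (s := {n : ℕ | Even n}))
    have hd := (hX.measurable_gridPath s h (le_refl (k + 1))).sub
      (hX.measurable_gridPath s h k.le_succ)
    exact Measurable.ite he hd hd.neg
  · exact (hX.hasFreshLaw s h k).ite_neg ((natFiltration X).le _)
      (by rw [gaussianReal_map_neg, neg_zero])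
      (hX.measurable_phase a b s h k (MeasurableSet.of_discrete (s := {n : ℕ | Even n})))

lemma IsBrownianMotion.map_gridPath [IsProbabilityMeasure P] (hX : IsBrownianMotion P X x)
    (s h : ℝ≥0) (k : ℕ) :
    P.map (fun ω => (X s ω, (gridPath X s h ω k - gridPath X s h ω 0,
        partialSups (fun j => gridPath X s h ω j - gridPath X s h ω 0) k))) =
      (P.map (X s)).prod (walkMaxLaw (gaussianReal 0 h) k) := by
  have := map_walk_partialSups (P := P) (gridFiltration X s h)
    (η := fun k ω => gridPath X s h ω (k + 1) - gridPath X s h ω k)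
    (fun k => (hX.measurable_gridPath s h (le_refl (k + 1))).sub
      (hX.measurable_gridPath s h k.le_succ)) (fun k => hX.hasFreshLaw s h k)
    (Z := X s) (hX.measurable_natFiltration le_self_add) k
  simpa only [Finset.sum_range_sub] using this

end brownian

section crossing

variable {Ω Ω' : Type*} [MeasurableSpace Ω] [MeasurableSpace Ω']
  {P : Measure Ω} {P' : Measure Ω'}
  {X : ℝ≥0 → Ω → ℝ} {Y : ℝ≥0 → Ω' → ℝ} {x : ℝ}

lemma aemeasurable_of_map_eq {α : Type*} [MeasurableSpace α] {f : Ω → α} {μ : Measure α}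
    [IsProbabilityMeasure μ] (h : P.map f = μ) : AEMeasurable f P := by
  have : NeZero (P.map f) := ⟨h ▸ IsProbabilityMeasure.ne_zero μ⟩
  exact aemeasurable_of_map_neZero this

lemma measure_preimage_of_map_eq {α : Type*} [MeasurableSpace α] {f : Ω → α} {μ : Measure α}
    [IsProbabilityMeasure μ] (h : P.map f = μ) {B : Set α} (hB : MeasurableSet B) :
    P (f ⁻¹' B) = μ B := by
  rw [← h, Measure.map_apply_of_aemeasurable (aemeasurable_of_map_eq h) hB]

lemma IsBrownianMotion.isProbabilityMeasure_map [IsProbabilityMeasure P]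
    (hX : IsBrownianMotion P X x) (s : ℝ≥0) :
    IsProbabilityMeasure (P.map (X s)) :=
  Measure.isProbabilityMeasure_map (hX.stronglyMeasurable s).measurable.aemeasurable

lemma IsBrownianMotion.aemeasurable_partialSups_foldWalk [IsProbabilityMeasure P]
    (hX : IsBrownianMotion P X x) (a b : ℝ)
    (h : ℝ≥0) (k : ℕ) :
    AEMeasurable (fun ω => partialSups (foldWalk a b (gridPath X 0 h ω)) k) P := by
  have := hX.isProbabilityMeasure_map 0
  exact (aemeasurable_of_map_eq (hX.map_foldWalk a b 0 h k)).snd.snd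

lemma measure_partialSups_foldWalk [IsProbabilityMeasure P] [IsProbabilityMeasure P']
    (hX : IsBrownianMotion P X x) (hY : IsBrownianMotion P' Y 0)
    (a b : ℝ) (h : ℝ≥0) (k : ℕ) {B : Set ℝ} (hB : MeasurableSet B) :
    P {ω | partialSups (foldWalk a b (gridPath X 0 h ω)) k ∈ B} =
      P' {ω | partialSups (gridPath Y 0 h ω) k ∈ B} := by
  have := hX.isProbabilityMeasure_map 0
  have := hY.isProbabilityMeasure_map 0
  have hBB : MeasurableSet ((Set.univ : Set ℝ) ×ˢ ((Prod.snd : ℝ × ℝ → ℝ) ⁻¹' B)) :=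
    MeasurableSet.univ.prod (measurable_snd hB)
  have h1 := measure_preimage_of_map_eq (hX.map_foldWalk a b 0 h k) hBB
  have h2 := measure_preimage_of_map_eq (hY.map_gridPath 0 h k) hBB
  rw [Measure.prod_prod, measure_univ] at h1 h2
  have h3 : P' {ω | partialSups (gridPath Y 0 h ω) k ∈ B} =
      P' {ω | partialSups (fun j => gridPath Y 0 h ω j - gridPath Y 0 h ω 0) k ∈ B} := by
    refine measure_congr (eventuallyEq_set.2 ?_)
    filter_upwards [hY.init] with ω hω
    have h0 : gridPath Y 0 h ω 0 = 0 := by simpa [gridPath] using hω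
    simp [h0]
  rw [h3]
  simp only [Set.preimage, Set.mem_prod, Set.mem_univ, true_and] at h1 h2
  exact h1.trans h2.symm

lemma IsBrownianMotion.map_eq_gaussianReal (hY : IsBrownianMotion P' Y 0) (s : ℝ≥0) :
    P'.map (Y s) = gaussianReal 0 s := by
  rw [← tsub_zero s, ← hY.gauss_incr 0 s (zero_le), tsub_zero]
  refine Measure.map_congr ?_
  filter_upwards [hY.init] with ω hω
  rw [hω, sub_zero]

lemma IsBrownianMotion.measure_runSup_eq_of_lt [IsProbabilityMeasure P']
    (hY : IsBrownianMotion P' Y 0) {s t : ℝ≥0}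
    (hs : 0 < s) (hst : s < t) (c : ℝ) :
    P' {ω | runSup Y t ω = c ∧ runSup Y s ω < c} = 0 := by
  have hr : 0 < t - s := tsub_pos_of_lt hst
  have key : ∀ δ : ℝ, 0 < δ → P' {ω | runSup Y t ω = c ∧ runSup Y s ω < c} ≤
      ENNReal.ofReal (√(2 * Real.pi * s))⁻¹ * ENNReal.ofReal (c - (c - δ)) := by
    intro δ hδ
    refine measure_le_of_ae_eventually_mem (B := fun N : ℕ => {ω | Y s ω +
      partialSups (fun j => gridPath Y s ((t - s) / (N + 1)) ω j -
        gridPath Y s ((t - s) / (N + 1)) ω 0) (N + 1) ∈ Set.Icc (c - δ) c}) ?_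
      (Frequently.of_forall fun N => ?_)
    · filter_upwards [hY.cont] with ω hc ⟨h1, h2⟩
      obtain ⟨u, hu, hu'⟩ := exists_eq_runSup hc t
      have hsu : s ≤ u := by
        by_contra hcon
        have := le_runSup hc (not_le.1 hcon).le
        linarith
      obtain ⟨v, rfl⟩ := exists_add_of_le hsu
      have hv : v ≤ t - s := le_tsub_of_add_le_left hu
      filter_upwards [eventually_grid_approx hc s (t - s) hr hδ] with N hN
      have h0 : gridPath Y s ((t - s) / (N + 1)) ω 0 = Y s ω := by simp [gridPath]
      have hv' := abs_lt.1 (hN v hv)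
      have hle := le_partialSups_of_le (fun j => gridPath Y s ((t - s) / (N + 1)) ω j -
        gridPath Y s ((t - s) / (N + 1)) ω 0) (floor_le_steps N hv)
      have hub : partialSups (fun j => gridPath Y s ((t - s) / (N + 1)) ω j -
          gridPath Y s ((t - s) / (N + 1)) ω 0) (N + 1) ≤ c - Y s ω := by
        refine partialSups_le_iff.2 fun k hk => ?_
        have hkt : s + k * ((t - s) / (N + 1)) ≤ t :=
          (add_le_add_right (steps_mul_le (t - s) N hk) s).trans_eq
            (add_tsub_cancel_of_le hst.le)
        have := le_runSup hc hkt
        rw [h0, gridPath]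
        linarith
      rw [h0] at hle hub ⊢
      simp only [gridPath] at hle hub hv' ⊢
      exact ⟨by linarith, by linarith⟩
    · have := hY.isProbabilityMeasure_map s
      have hmeas : MeasurableSet {q : ℝ × (ℝ × ℝ) | q.1 + q.2.2 ∈ Set.Icc (c - δ) c} :=
        measurableSet_Icc.preimage (by fun_prop)
      have h1 := measure_preimage_of_map_eq
        (hY.map_gridPath s ((t - s) / (N + 1)) (N + 1)) hmeas
      refine h1.le.trans ?_
      rw [hY.map_eq_gaussianReal]
      exact gaussianReal_prod_add_mem_Icc_le hs.ne' _ _ _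
  have hlim : Tendsto (fun δ : ℝ => ENNReal.ofReal (√(2 * Real.pi * s))⁻¹ *
      ENNReal.ofReal (c - (c - δ))) (𝓝[>] 0) (𝓝 0) := by
    have h1 : Tendsto (fun δ : ℝ => ENNReal.ofReal (c - (c - δ))) (𝓝[>] 0) (𝓝 0) := by
      have : Continuous fun δ : ℝ => ENNReal.ofReal (c - (c - δ)) :=
        ENNReal.continuous_ofReal.comp (by fun_prop)
      simpa using (this.tendsto 0).mono_left nhdsWithin_le_nhds
    have h2 := ENNReal.Tendsto.const_mul (a := ENNReal.ofReal (√(2 * Real.pi * s))⁻¹) h1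
      (Or.inr ENNReal.ofReal_ne_top)
    rwa [mul_zero] at h2
  exact nonpos_iff_eq_zero.1 (ge_of_tendsto hlim (eventually_mem_nhdsWithin.mono key))

lemma IsBrownianMotion.aemeasurable_runSup (hX : IsBrownianMotion P X x) {t : ℝ≥0} (ht : 0 < t) :
    AEMeasurable (runSup X t) P := by
  refine aemeasurable_of_tendsto_metrizable_ae atTop
    (f := fun (N : ℕ) ω => partialSups (gridPath X 0 (t / (N + 1)) ω) (N + 1))
    (fun N => (measurable_partialSups _ fun j _ =>
      (hX.stronglyMeasurable _).measurable).aemeasurable) ?_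
  filter_upwards [hX.cont] with ω hc
  exact tendsto_partialSups_gridPath hc ht

lemma IsBrownianMotion.measure_runSup_eq [IsProbabilityMeasure P']
    (hY : IsBrownianMotion P' Y 0) {t : ℝ≥0} (ht : 0 < t)
    {c : ℝ} (hcpos : 0 < c) : P' {ω | runSup Y t ω = c} = 0 := by
  have hpos : ∀ j : ℕ, 0 < t / (j + 2) := fun j => by positivity
  have hlt : ∀ j : ℕ, t / (j + 2) < t := fun j =>
    div_lt_self ht (by norm_cast; omega)
  have hle : ∀ j : ℕ, P' {ω | runSup Y t ω = c} ≤ P' {ω | c ≤ runSup Y (t / (j + 2)) ω} := by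
    intro j
    calc P' {ω | runSup Y t ω = c}
        ≤ P' ({ω | runSup Y t ω = c ∧ runSup Y (t / (j + 2)) ω < c} ∪
            {ω | c ≤ runSup Y (t / (j + 2)) ω}) :=
          measure_mono fun ω hω => (lt_or_ge (runSup Y (t / (j + 2)) ω) c).imp
            (fun h => ⟨hω, h⟩) id
      _ ≤ _ := measure_union_le _ _
      _ = _ := by rw [hY.measure_runSup_eq_of_lt (hpos j) (hlt j), zero_add]
  refine nonpos_iff_eq_zero.1 ?_
  rw [← measure_empty (μ := P')]
  refine le_measure_of_ae_eventually_notMem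
    (B := fun j : ℕ => {ω | c ≤ runSup Y (t / (j + 2)) ω}) (fun j =>
      (hY.aemeasurable_runSup (hpos j)).nullMeasurableSet_preimage measurableSet_Ici) ?_
    (Frequently.of_forall hle)
  filter_upwards [hY.cont, hY.init] with ω hc h0 _
  obtain ⟨ε, hε, H⟩ := Metric.continuousAt_iff.1 (hc.continuousAt (x := 0)) c hcpos
  have hlim : Tendsto (fun j : ℕ => (t : ℝ) / (j + 2)) atTop (𝓝 0) :=
    tendsto_const_nhds.div_atTop (tendsto_atTop_add_const_right _ _ tendsto_natCast_atTop_atTop)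
  filter_upwards [hlim.eventually_lt_const hε] with j hj hmem
  obtain ⟨u, hu, hu'⟩ := exists_eq_runSup hc (t / (j + 2))
  have hu2 : (u : ℝ) ≤ t / (j + 2) := by exact_mod_cast hu
  have hd := H (x := u) (by
    rw [NNReal.dist_eq, NNReal.coe_zero, sub_zero, abs_of_nonneg u.coe_nonneg]
    exact hu2.trans_lt hj)
  rw [h0, Real.dist_eq, sub_zero, hu'] at hd
  have := (abs_lt.1 hd).2
  have hmem' : c ≤ runSup Y (t / (j + 2)) ω := hmem
  linarith

lemma measure_dcSigma_le_le [IsProbabilityMeasure P] [IsProbabilityMeasure P']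
    (hX : IsBrownianMotion P X x) (hY : IsBrownianMotion P' Y 0)
    {a b : ℝ} (hab : a < b) {t : ℝ≥0} (ht : 0 < t) {n : ℕ} (hn : 1 ≤ n) :
    P {ω | dcSigma a b X ω (2 * n) ≤ t} ≤
      P' {ω | |b - x| + (2 * (n : ℝ) - 1) * (b - a) ≤ runSup Y t ω} := by
  have hn' : (1 : ℝ) ≤ n := by exact_mod_cast hn
  have key : ∀ δ : ℝ, 0 < δ → a + δ < b - δ → P {ω | dcSigma a b X ω (2 * n) ≤ t} ≤
      P' {ω | |b - x| + (2 * (n : ℝ) - 1) * (b - a) - 4 * n * δ ≤ runSup Y t ω} := by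
    intro δ hδ hab'
    refine measure_le_of_ae_eventually_mem (B := fun N : ℕ => {ω | 2 * n ≤
      phase (a + δ) (b - δ) (gridPath X 0 (t / (N + 1)) ω) (N + 1)}) ?_
      (Frequently.of_forall fun N => ?_)
    · filter_upwards [hX.cont] with ω hc hω
      exact eventually_le_phase hc hδ hab' ht _ hω
    · calc _ ≤ P {ω | partialSups (foldWalk (a + δ) (b - δ) (gridPath X 0 (t / (N + 1)) ω))
              (N + 1) ∈ Set.Ici (|b - x| + (2 * (n : ℝ) - 1) * (b - a) - 4 * n * δ)} := by
            refine measure_mono_ae ?_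
            filter_upwards [hX.init] with ω h0 hω
            have hω' : 2 * n ≤ phase (a + δ) (b - δ) (gridPath X 0 (t / (N + 1)) ω) (N + 1) := hω
            have h1 := le_partialSups_foldWalk (a + δ) (b - δ) (gridPath X 0 (t / (N + 1)) ω)
              (N + 1) (by omega)
            have h2 : gridPath X 0 (t / (N + 1)) ω 0 = x := by simpa [gridPath] using h0
            rw [h2] at h1
            have h3 : (2 * n : ℝ) ≤
                phase (a + δ) (b - δ) (gridPath X 0 (t / (N + 1)) ω) (N + 1) := by
              exact_mod_cast hω'
            have h4 : |b - x| - δ ≤ |b - δ - x| := by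
              have := abs_add_le (b - δ - x) δ
              rw [abs_of_pos hδ] at this
              have h5 : b - δ - x + δ = b - x := by ring
              rw [h5] at this
              linarith
            have h6 := mul_le_mul_of_nonneg_right h3 (by linarith : 0 ≤ b - δ - (a + δ))
            refine le_trans ?_ h1
            linarith
        _ = P' {ω | partialSups (gridPath Y 0 (t / (N + 1)) ω) (N + 1) ∈
              Set.Ici (|b - x| + (2 * (n : ℝ) - 1) * (b - a) - 4 * n * δ)} :=
            measure_partialSups_foldWalk hX hY _ _ _ _ measurableSet_Ici
        _ ≤ _ := by
            refine measure_mono_ae ?_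
            filter_upwards [hY.cont] with ω hc hω
            exact le_trans hω (partialSups_gridPath_le_runSup hc t N)
  have hδ : ∀ j : ℕ, 0 < (b - a) / (j + 3) := fun j => div_pos (by linarith) (by positivity)
  refine le_measure_of_ae_eventually_notMem (B := fun j : ℕ => {ω |
    |b - x| + (2 * (n : ℝ) - 1) * (b - a) - 4 * n * ((b - a) / (j + 3)) ≤ runSup Y t ω})
    (fun j => (hY.aemeasurable_runSup ht).nullMeasurableSet_preimage measurableSet_Ici) ?_
    (Frequently.of_forall fun j => key _ (hδ j) ?_)
  · refine Eventually.of_forall fun ω hω => ?_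
    have hlim : Tendsto (fun j : ℕ => |b - x| + (2 * (n : ℝ) - 1) * (b - a) -
        4 * n * ((b - a) / (j + 3))) atTop
        (𝓝 (|b - x| + (2 * (n : ℝ) - 1) * (b - a) - 4 * n * 0)) :=
      tendsto_const_nhds.sub (tendsto_const_nhds.mul (tendsto_const_nhds.div_atTop
        (tendsto_atTop_add_const_right _ _ tendsto_natCast_atTop_atTop)))
    rw [mul_zero, sub_zero] at hlim
    exact (hlim.eventually_const_lt (not_le.1 hω)).mono fun j hj => not_le.2 hj
  · have h1 := hδ j
    have h2 : (b - a) / (j + 3) ≤ (b - a) / 3 := by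
      have : (0 : ℝ) ≤ j := j.cast_nonneg
      gcongr
      linarith
    linarith

lemma le_measure_dcSigma_le [IsProbabilityMeasure P] [IsProbabilityMeasure P']
    (hX : IsBrownianMotion P X x) (hY : IsBrownianMotion P' Y 0)
    {a b : ℝ} (hab : a < b) {t : ℝ≥0} (ht : 0 < t) {n : ℕ} :
    P' {ω | |b - x| + (2 * (n : ℝ) - 1) * (b - a) < runSup Y t ω} ≤
      P {ω | dcSigma a b X ω (2 * n) ≤ t} := by
  have key : ∀ ε : ℝ, 0 < ε →
      P' {ω | |b - x| + (2 * (n : ℝ) - 1) * (b - a) + 4 * n * ε < runSup Y t ω} ≤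
        P {ω | dcSigma a b X ω (2 * n) ≤ t} := by
    intro ε hε
    refine le_of_forall_lt_imp_le_of_dense fun r hr => ?_
    have hfreq : ∀ᶠ N : ℕ in atTop, r < P' {ω | partialSups (gridPath Y 0 (t / (N + 1)) ω) (N + 1) ∈
        Set.Ioi (|b - x| + (2 * (n : ℝ) - 1) * (b - a) + 4 * n * ε)} := by
      by_contra hcon
      refine hr.not_ge (measure_le_of_ae_eventually_mem ?_
        ((not_eventually.1 hcon).mono fun N hN => not_lt.1 hN))
      filter_upwards [hY.cont] with ω hc hω
      exact (tendsto_partialSups_gridPath hc ht).eventually_const_lt hω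
    refine le_measure_of_ae_eventually_notMem (B := fun N : ℕ => {ω |
      partialSups (foldWalk a b (gridPath X 0 (t / (N + 1)) ω)) (N + 1) ∈
        Set.Ioi (|b - x| + (2 * (n : ℝ) - 1) * (b - a) + 4 * n * ε)})
      (fun N => (hX.aemeasurable_partialSups_foldWalk a b _ _).nullMeasurableSet_preimage
        measurableSet_Ioi) ?_ (hfreq.frequently.mono fun N hN => ?_)
    · filter_upwards [hX.cont, hX.init] with ω hc h0 hω
      filter_upwards [eventually_osc_lt hc t hε t] with N hN
      have hp : phase a b (gridPath X 0 (t / (N + 1)) ω) (N + 1) < 2 * n := by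
        by_contra hcon
        have := dcSigma_le_of_le_phase _ _ _ (not_lt.1 hcon)
        rw [steps_mul] at this
        exact hω this
      have h1 := partialSups_foldWalk_le hab (gridPath X 0 (t / (N + 1)) ω) hε.le
        (m := N + 1) fun k hk => ?_
      · have h2 : gridPath X 0 (t / (N + 1)) ω 0 = x := by simpa [gridPath] using h0
        rw [h2] at h1
        have h3 : (phase a b (gridPath X 0 (t / (N + 1)) ω) (N + 1) : ℝ) ≤ 2 * n - 1 := by
          rw [le_sub_iff_add_le]
          exact_mod_cast hp
        have h4 := mul_le_mul_of_nonneg_right h3 (sub_pos.2 hab).le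
        have h5 := mul_le_mul_of_nonneg_right h3 hε.le
        refine not_lt.2 (h1.trans ?_)
        linarith
      · simp only [gridPath, zero_add]
        refine (hN _ (steps_mul_le t N hk) _ (steps_mul_le t N hk.le) ?_).le
        rw [NNReal.dist_eq]
        push_cast
        rw [← sub_mul, add_sub_cancel_left, one_mul, abs_of_nonneg (by positivity)]
    · rw [measure_partialSups_foldWalk hX hY a b _ _ measurableSet_Ioi]
      exact hN.le
  have hδ : ∀ j : ℕ, (0 : ℝ) < 1 / (j + 1) := fun j => by positivity
  refine measure_le_of_ae_eventually_mem (Eventually.of_forall fun ω hω => ?_)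
    (Frequently.of_forall fun j : ℕ => key _ (hδ j))
  have hlim := (tendsto_one_div_add_atTop_nhds_zero_nat (𝕜 := ℝ)).const_mul (4 * (n : ℝ))
    |>.const_add (|b - x| + (2 * (n : ℝ) - 1) * (b - a))
  rw [mul_zero, add_zero] at hlim
  exact hlim.eventually_lt_const hω

end crossing

/-- `P_x(D_t ≥ n) = P_0(T_c ≤ t) = P_0(S_t ≥ c)` where
`c = |b - x| + (2n - 1)(b - a)`. -/
theorem downcrossing_tail
    {Ω Ω' : Type*} [m : MeasurableSpace Ω] [m' : MeasurableSpace Ω']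
    (P : Measure Ω) [IsProbabilityMeasure P] (P' : Measure Ω') [IsProbabilityMeasure P']
    (a b : ℝ) (hab : a < b) (x : ℝ)
    (X : ℝ≥0 → Ω → ℝ) (hX : IsBrownianMotion P X x)
    (Y : ℝ≥0 → Ω' → ℝ) (hY : IsBrownianMotion P' Y 0)
    (t : ℝ≥0) (ht : 0 < t) (n : ℕ) (hn : 1 ≤ n)
    (c : ℝ) (hc : c = |b - x| + (2 * (n : ℝ) - 1) * (b - a)) :
    P {ω | n ≤ dcD a b X t ω} = P' {ω | hitTime Y c ω ≤ (t : ℝ≥0∞)} ∧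
      P' {ω | hitTime Y c ω ≤ (t : ℝ≥0∞)} = P' {ω | c ≤ runSup Y t ω} := by
  have hn' : (1 : ℝ) ≤ n := by exact_mod_cast hn
  have hcpos : 0 < c := by
    have h1 : 0 < (2 * (n : ℝ) - 1) * (b - a) := mul_pos (by linarith) (by linarith)
    linarith [abs_nonneg (b - x)]
  have hdc : P {ω | n ≤ dcD a b X t ω} = P {ω | dcSigma a b X ω (2 * n) ≤ t} := by
    refine measure_congr (eventuallyEq_set.2 ?_)
    filter_upwards [hX.cont] with ω hω
    exact le_dcD_iff hω hab ht hn
  have hhit : P' {ω | hitTime Y c ω ≤ (t : ℝ≥0∞)} = P' {ω | c ≤ runSup Y t ω} := by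
    refine measure_congr (eventuallyEq_set.2 ?_)
    filter_upwards [hY.cont, hY.init] with ω hω h0
    exact hitTime_le_iff hω h0 hcpos.le t
  have hstrict : P' {ω | c ≤ runSup Y t ω} ≤ P' {ω | c < runSup Y t ω} := by
    refine (measure_mono fun ω (hω : c ≤ runSup Y t ω) => ?_).trans
      ((measure_union_le {ω | c < runSup Y t ω} {ω | runSup Y t ω = c}).trans_eq ?_)
    · exact hω.lt_or_eq.imp id Eq.symm
    · rw [hY.measure_runSup_eq ht hcpos, add_zero]
  refine ⟨?_, hhit⟩
  rw [hdc, hhit]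
  subst hc
  exact le_antisymm (measure_dcSigma_le_le hX hY hab ht hn)
    (hstrict.trans (le_measure_dcSigma_le hX hY hab ht))

end
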